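/- (Uniform local parabolic energy bound.) For every n ≥ 2 and E > 0 there exists C = C(n,E) with the following property. Let Γ be a smooth solution of the Yang–Mills flow on ℝⁿ × [−1,1] whose spatial support is contained in a fixed compact set for all times and with sup_{t ∈ [−1,1]} (1/2)∫_{ℝⁿ} |F_t|² dx ≤ E. Then for every z = (x₀,t₀) with t₀ ∈ [−1/2, 0] and every r ∈ (0, 1/4]: r^{2−n} ∫_{P_r(z)} |F_t(x)|² dx dt ≤ C. -/

import Mathlib

open MeasureTheory Filter Set
open scoped ContDiff ENNReal

noncomputable section

abbrev Mat (k : ℕ) := Fin k → Fin k → ℝ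

def mmul {k : ℕ} (A B : Mat k) : Mat k := fun i j => ∑ l, A i l * B l j

def mbra {k : ℕ} (A B : Mat k) : Mat k := mmul A B - mmul B A

def minner {k : ℕ} (A B : Mat k) : ℝ := ∑ i, ∑ j, A i j * B i j

def msq {k : ℕ} (A : Mat k) : ℝ := minner A A

abbrev Conn (n k : ℕ) := ℝ → (Fin n → ℝ) → Fin n → Mat k

/-- Spatial partial derivative in the `i`-th coordinate direction. -/
def pd {n : ℕ} {E : Type*} [NormedAddCommGroup E] [NormedSpace ℝ E]
    (f : (Fin n → ℝ) → E) (x : Fin n → ℝ) (i : Fin n) : E :=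
  fderiv ℝ f x (Pi.single i 1)

/-- Time derivative of a time-dependent connection. -/
def tderiv {n k : ℕ} (Γ : Conn n k) (t : ℝ) (x : Fin n → ℝ) (j : Fin n) : Mat k :=
  deriv (fun s => Γ s x j) t

/-- Curvature `(F_t)_{ij} = ∂_i(Γ_t)_j − ∂_j(Γ_t)_i + [(Γ_t)_i,(Γ_t)_j]`. -/
def curv {n k : ℕ} (Γ : Conn n k) (t : ℝ) (x : Fin n → ℝ) (i j : Fin n) : Mat k :=
  pd (fun y => Γ t y j) x i - pd (fun y => Γ t y i) x j + mbra (Γ t x i) (Γ t x j)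

/-- Covariant derivative `∇_i om = ∂_i om + [(Γ_t)_i, om]`. -/
def covD {n k : ℕ} (Γ : Conn n k) (t : ℝ) (om : (Fin n → ℝ) → Mat k)
    (x : Fin n → ℝ) (i : Fin n) : Mat k :=
  pd om x i + mbra (Γ t x i) (om x)

/-- A smooth time-dependent connection: jointly smooth in `(t,x)`, with values in the
skew-symmetric matrices `𝔤`. -/
def IsSmoothConn {n k : ℕ} (Γ : Conn n k) : Prop :=
  ContDiff ℝ ∞ (fun p : ℝ × (Fin n → ℝ) => Γ p.1 p.2)
    ∧ ∀ t x i a b, Γ t x i b a = - (Γ t x i a b)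

/-- The Yang–Mills flow equation `∂_t(Γ_t)_j = Σᵢ ∇_i(F_t)_{ij}` on a time interval `I`. -/
def IsYMFlowOn {n k : ℕ} (Γ : Conn n k) (I : Set ℝ) : Prop :=
  ∀ t ∈ I, ∀ x j, tderiv Γ t x j = ∑ i, covD Γ t (fun y => curv Γ t y i j) x i

/-- `|F_t|²(x) = Σ_{i,j} |(F_t)_{ij}(x)|²`. -/
def normF2 {n k : ℕ} (Γ : Conn n k) (t : ℝ) (x : Fin n → ℝ) : ℝ :=
  ∑ i, ∑ j, msq (curv Γ t x i j)

/-- The backwards heat kernel `G_{z₀}(x,t)` based at `z₀ = (x₀,t₀)`. -/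
def gauss {n : ℕ} (z0 : (Fin n → ℝ) × ℝ) (x : Fin n → ℝ) (t : ℝ) : ℝ :=
  (4 * Real.pi * (z0.2 - t)) ^ (-(n : ℝ) / 2) *
    Real.exp (-(∑ i, (x i - z0.1 i) ^ 2) / (4 * (z0.2 - t)))

/-- The entropy `Φ_{z₀}(R;Γ)`. -/
def Phi {n k : ℕ} (Γ : Conn n k) (z0 : (Fin n → ℝ) × ℝ) (R : ℝ) : ℝ :=
  R ^ 4 / 2 * ∫ x : Fin n → ℝ, normF2 Γ (z0.2 - R ^ 2) x * gauss z0 x (z0.2 - R ^ 2)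

/-- The entropy `Ψ_{z₀}(R;Γ)`. -/
def Psi {n k : ℕ} (Γ : Conn n k) (z0 : (Fin n → ℝ) × ℝ) (R : ℝ) : ℝ :=
  R ^ 2 / 2 * ∫ t in Icc (z0.2 - 4 * R ^ 2) (z0.2 - R ^ 2),
    ∫ x : Fin n → ℝ, normF2 Γ t x * gauss z0 x t

/-- The parabolically rescaled connection `Γ^{λ,z₀}`. -/
def rescale {n k : ℕ} (Γ : Conn n k) (z0 : (Fin n → ℝ) × ℝ) (lam : ℝ) : Conn n k :=
  fun t x i => lam • Γ (lam ^ 2 * t + z0.2) (fun m => lam * x m + z0.1 m) i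

/-- Spatial support of `Γ_t` contained in `K` for all `t`. -/
def SuppIn {n k : ℕ} (Γ : Conn n k) (K : Set (Fin n → ℝ)) : Prop :=
  ∀ t x, x ∉ K → Γ t x = 0

/-! ### Matrix algebra -/

lemma mmul_eq {k : ℕ} (A B : Mat k) :
    mmul A B = ((Matrix.of A * Matrix.of B : Matrix (Fin k) (Fin k) ℝ) : Mat k) := rfl

lemma minner_eq {k : ℕ} (A B : Mat k) :
    minner A B = ((Matrix.of A).transpose * Matrix.of B).trace := by
  simp only [minner, Matrix.trace, Matrix.diag_apply, Matrix.mul_apply, Matrix.transpose_apply,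
    Matrix.of_apply]
  exact Finset.sum_comm

/-- The commutator as a continuous bilinear map. -/
def braL (k : ℕ) : Mat k →L[ℝ] Mat k →L[ℝ] Mat k :=
  LinearMap.toContinuousLinearMap (LinearMap.toContinuousLinearMap.toLinearMap ∘ₗ
    LinearMap.mk₂ ℝ mbra
      (fun A A' B => by
        simp only [mbra, mmul_eq, ← Matrix.of_add_of, add_mul, mul_add]
        exact add_sub_add_comm _ _ _ _)
      (fun c A B => by
        simp only [mbra, mmul_eq, ← Matrix.smul_of, smul_mul_assoc, mul_smul_comm]
        exact (smul_sub c _ _).symm)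
      (fun A B B' => by
        simp only [mbra, mmul_eq, ← Matrix.of_add_of, add_mul, mul_add]
        exact add_sub_add_comm _ _ _ _)
      (fun c A B => by
        simp only [mbra, mmul_eq, ← Matrix.smul_of, smul_mul_assoc, mul_smul_comm]
        exact (smul_sub c _ _).symm))

@[simp] lemma braL_apply {k : ℕ} (A B : Mat k) : braL k A B = mbra A B := rfl

/-- The trace inner product as a continuous bilinear map. -/
def innL (k : ℕ) : Mat k →L[ℝ] Mat k →L[ℝ] ℝ :=
  LinearMap.toContinuousLinearMap (LinearMap.toContinuousLinearMap.toLinearMap ∘ₗ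
    LinearMap.mk₂ ℝ minner
      (fun A A' B => by simp [minner, add_mul, Finset.sum_add_distrib])
      (fun c A B => by simp [minner, Finset.mul_sum, mul_assoc])
      (fun A B B' => by simp [minner, mul_add, Finset.sum_add_distrib])
      (fun c A B => by simp [minner, Finset.mul_sum, mul_left_comm]))

@[simp] lemma innL_apply {k : ℕ} (A B : Mat k) : innL k A B = minner A B := rfl

lemma mbra_antisymm {k : ℕ} (A B : Mat k) : mbra A B = -mbra B A :=
  (neg_sub (mmul B A) (mmul A B)).symm

lemma mbra_jacobi {k : ℕ} (A B C : Mat k) :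
    mbra A (mbra B C) + mbra B (mbra C A) + mbra C (mbra A B) = 0 := by
  have h (A B C : Matrix (Fin k) (Fin k) ℝ) :
      (A * (B * C - C * B) - (B * C - C * B) * A) + (B * (C * A - A * C) - (C * A - A * C) * B)
        + (C * (A * B - B * A) - (A * B - B * A) * C) = 0 := by noncomm_ring
  exact h A B C

lemma minner_comm {k : ℕ} (A B : Mat k) : minner A B = minner B A := by
  simp only [minner, mul_comm]

lemma msq_nonneg {k : ℕ} (A : Mat k) : 0 ≤ msq A := by
  unfold msq minner
  exact Finset.sum_nonneg fun i _ => Finset.sum_nonneg fun j _ => mul_self_nonneg (A i j)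

/-- Bracketing with a skew-symmetric matrix is skew-adjoint for the trace inner product. -/
lemma minner_mbra {k : ℕ} (A B C : Mat k) (hC : ∀ i j, C j i = -C i j) :
    minner (mbra C A) B + minner A (mbra C B) = 0 := by
  have h (A B C : Matrix (Fin k) (Fin k) ℝ) (hC : C.transpose = -C) :
      ((C * A - A * C).transpose * B).trace + (A.transpose * (C * B - B * C)).trace = 0 := by
    simp only [Matrix.transpose_sub, Matrix.transpose_mul, hC, sub_mul, mul_sub,
      Matrix.trace_sub, Matrix.mul_neg, Matrix.neg_mul, Matrix.trace_neg, Matrix.mul_assoc]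
    rw [Matrix.trace_mul_comm C (A.transpose * B), Matrix.mul_assoc]
    ring
  rw [minner_eq, minner_eq]
  exact h A B C (by ext i j; exact hC i j)

/-! ### Directional derivatives -/

section Directional

variable {V L : Type*} [NormedAddCommGroup V] [NormedSpace ℝ V]
  [NormedAddCommGroup L] [NormedSpace ℝ L]

/-- Directional derivative of `f` along the constant vector field `v`. -/
def dirD (v : V) (f : V → L) (p : V) : L := fderiv ℝ f p v

lemma contDiff_dirD {f : V → L} (hf : ContDiff ℝ ∞ f) (v : V) : ContDiff ℝ ∞ (dirD v f) :=
  (hf.fderiv_right (m := ∞) (by simp)).clm_apply contDiff_const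

lemma dirD_comm {f : V → L} (hf : ContDiff ℝ ∞ f) (u v p : V) :
    dirD u (dirD v f) p = dirD v (dirD u f) p := by
  have hd : DifferentiableAt ℝ (fderiv ℝ f) p :=
    (hf.fderiv_right (m := ∞) (by simp)).differentiable (by simp) p
  have h (u v : V) : dirD u (dirD v f) p = fderiv ℝ (fderiv ℝ f) p u v := by
    unfold dirD
    rw [fderiv_clm_apply hd (differentiableAt_const v)]
    simp
  rw [h, h]
  exact (hf.contDiffAt.isSymmSndFDerivAt (by simpa using ENat.LEInfty.out)).eq u v

lemma dirD_add {f g : V → L} (hf : ContDiff ℝ ∞ f) (hg : ContDiff ℝ ∞ g) (v p : V) :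
    dirD v (fun q => f q + g q) p = dirD v f p + dirD v g p := by
  unfold dirD
  rw [fderiv_fun_add (hf.differentiable (by simp) p) (hg.differentiable (by simp) p)]
  rfl

lemma dirD_sub {f g : V → L} (hf : ContDiff ℝ ∞ f) (hg : ContDiff ℝ ∞ g) (v p : V) :
    dirD v (fun q => f q - g q) p = dirD v f p - dirD v g p := by
  unfold dirD
  rw [fderiv_fun_sub (hf.differentiable (by simp) p) (hg.differentiable (by simp) p)]
  rfl

lemma dirD_sum {ι : Type*} (s : Finset ι) {f : ι → V → L} (hf : ∀ i, ContDiff ℝ ∞ (f i))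
    (v p : V) : dirD v (fun q => ∑ i ∈ s, f i q) p = ∑ i ∈ s, dirD v (f i) p := by
  unfold dirD
  rw [fderiv_fun_sum fun i _ => (hf i).differentiable (by simp) p]
  simp

lemma dirD_mbra {k : ℕ} {f g : V → Mat k} (hf : ContDiff ℝ ∞ f) (hg : ContDiff ℝ ∞ g) (v p : V) :
    dirD v (fun q => mbra (f q) (g q)) p = mbra (dirD v f p) (g p) + mbra (f p) (dirD v g p) := by
  have h := (braL k).fderiv_of_bilinear (hf.differentiable (by simp) p)
    (hg.differentiable (by simp) p)
  simp only [braL_apply] at h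
  unfold dirD
  rw [h]
  simp [add_comm]

lemma dirD_minner {k : ℕ} {f g : V → Mat k} (hf : ContDiff ℝ ∞ f) (hg : ContDiff ℝ ∞ g)
    (v p : V) :
    dirD v (fun q => minner (f q) (g q)) p =
      minner (dirD v f p) (g p) + minner (f p) (dirD v g p) := by
  have h := (innL k).fderiv_of_bilinear (hf.differentiable (by simp) p)
    (hg.differentiable (by simp) p)
  simp only [innL_apply] at h
  unfold dirD
  rw [h]
  simp [add_comm]

lemma contDiff_mbra {k : ℕ} {f g : V → Mat k} (hf : ContDiff ℝ ∞ f) (hg : ContDiff ℝ ∞ g) :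
    ContDiff ℝ ∞ (fun q => mbra (f q) (g q)) :=
  ((braL k).contDiff.comp hf).clm_apply hg

lemma contDiff_minner {k : ℕ} {f g : V → Mat k} (hf : ContDiff ℝ ∞ f) (hg : ContDiff ℝ ∞ g) :
    ContDiff ℝ ∞ (fun q => minner (f q) (g q)) :=
  ((innL k).contDiff.comp hf).clm_apply hg

/-- Covariant derivative along `v` when the connection has component `a` along `v`. -/
def cov {k : ℕ} (v : V) (a : V → Mat k) (f : V → Mat k) (p : V) : Mat k :=
  dirD v f p + mbra (a p) (f p)

/-- Curvature component in the directions `u, v` for connection components `a, b`. -/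
def curvD {k : ℕ} (u v : V) (a b : V → Mat k) (p : V) : Mat k :=
  dirD u b p - dirD v a p + mbra (a p) (b p)

lemma contDiff_curvD {k : ℕ} {a b : V → Mat k} (ha : ContDiff ℝ ∞ a) (hb : ContDiff ℝ ∞ b)
    (u v : V) : ContDiff ℝ ∞ (curvD u v a b) :=
  ((contDiff_dirD hb u).sub (contDiff_dirD ha v)).add (contDiff_mbra ha hb)

lemma curvD_antisymm {k : ℕ} (u v : V) (a b : V → Mat k) (p : V) :
    curvD u v a b p = -curvD v u b a p := by
  unfold curvD
  rw [mbra_antisymm]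
  abel

lemma cov_curvD {k : ℕ} {a b : V → Mat k} (c : V → Mat k) (ha : ContDiff ℝ ∞ a)
    (hb : ContDiff ℝ ∞ b) (u v w p : V) :
    cov w c (curvD u v a b) p = dirD w (dirD u b) p - dirD w (dirD v a) p
      + (mbra (dirD w a p) (b p) + mbra (a p) (dirD w b p))
      + (mbra (c p) (dirD u b p) - mbra (c p) (dirD v a p) + mbra (c p) (mbra (a p) (b p))) := by
  unfold cov
  have h1 : dirD w (curvD u v a b) p = dirD w (dirD u b) p - dirD w (dirD v a) p
      + (mbra (dirD w a p) (b p) + mbra (a p) (dirD w b p)) := by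
    unfold curvD
    rw [dirD_add ((contDiff_dirD hb u).sub (contDiff_dirD ha v)) (contDiff_mbra ha hb),
      dirD_sub (contDiff_dirD hb u) (contDiff_dirD ha v), dirD_mbra ha hb]
  rw [h1]
  unfold curvD
  simp only [← braL_apply, map_add, map_sub]

/-- The second Bianchi identity. -/
lemma bianchi {k : ℕ} {a b c : V → Mat k} (ha : ContDiff ℝ ∞ a) (hb : ContDiff ℝ ∞ b)
    (hc : ContDiff ℝ ∞ c) (u v w p : V) :
    cov u a (curvD v w b c) p + cov v b (curvD w u c a) p + cov w c (curvD u v a b) p = 0 := by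
  rw [cov_curvD a hb hc, cov_curvD b hc ha, cov_curvD c ha hb, dirD_comm hc u v,
    dirD_comm hb u w, dirD_comm ha v w, mbra_antisymm (dirD u b p), mbra_antisymm (dirD v c p),
    mbra_antisymm (dirD w a p)]
  have := mbra_jacobi (a p) (b p) (c p)
  refine Eq.trans ?_ this
  abel

lemma dirD_minner_cov {k : ℕ} {a f g : V → Mat k} (ha : ∀ p i j, a p j i = -a p i j)
    (hf : ContDiff ℝ ∞ f) (hg : ContDiff ℝ ∞ g) (v p : V) :
    dirD v (fun q => minner (f q) (g q)) p =
      minner (cov v a f p) (g p) + minner (f p) (cov v a g p) := by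
  have h := minner_mbra (f p) (g p) (a p) (ha p)
  rw [dirD_minner hf hg]
  unfold cov
  simp only [← innL_apply, map_add, add_apply] at h ⊢
  linarith

lemma hasDerivAt_dirD {f : V → L} (hf : ContDiff ℝ ∞ f) {γ : ℝ → V} {v : V} {s : ℝ}
    (hγ : HasDerivAt γ v s) : HasDerivAt (fun r => f (γ r)) (dirD v f (γ s)) s :=
  ((hf.differentiable (by simp) (γ s)).hasFDerivAt).comp_hasDerivAt s hγ

end Directional

/-! ### Pointwise identities along the flow -/

section Pointwise

/-- Spatial coordinate direction in space-time. -/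
def ex {n : ℕ} (i : Fin n) : ℝ × (Fin n → ℝ) := (0, Pi.single i 1)

/-- Time direction in space-time. -/
def et {n : ℕ} : ℝ × (Fin n → ℝ) := (1, 0)

variable {n k : ℕ} {Γ : Conn n k}

/-- Connection component as a function on space-time. -/
def comp (Γ : Conn n k) (i : Fin n) (p : ℝ × (Fin n → ℝ)) : Mat k := Γ p.1 p.2 i

/-- Curvature component as a function on space-time. -/
def curvST (Γ : Conn n k) (i j : Fin n) : ℝ × (Fin n → ℝ) → Mat k :=
  curvD (ex i) (ex j) (comp Γ i) (comp Γ j)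

/-- Time derivative of the connection as a function on space-time. -/
def velST (Γ : Conn n k) (j : Fin n) : ℝ × (Fin n → ℝ) → Mat k := dirD et (comp Γ j)

/-- `|F|²` as a function on space-time. -/
def energyST (Γ : Conn n k) (p : ℝ × (Fin n → ℝ)) : ℝ :=
  ∑ i, ∑ j, minner (curvST Γ i j p) (curvST Γ i j p)

/-- The momentum density `∑ⱼ ⟨F_{ij}, ∂_tΓ_j⟩`. -/
def momST (Γ : Conn n k) (i : Fin n) (p : ℝ × (Fin n → ℝ)) : ℝ :=
  ∑ j, minner (curvST Γ i j p) (velST Γ j p)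

/-- The contraction `∑ⱼ ⟨F_{ij}, F_{lj}⟩`. -/
def contrST (Γ : Conn n k) (i l : Fin n) (p : ℝ × (Fin n → ℝ)) : ℝ :=
  ∑ j, minner (curvST Γ i j p) (curvST Γ l j p)

lemma contDiff_comp (h : IsSmoothConn Γ) (i : Fin n) : ContDiff ℝ ∞ (comp Γ i) :=
  contDiff_pi.1 h.1 i

lemma comp_skew (h : IsSmoothConn Γ) (i : Fin n) (p : ℝ × (Fin n → ℝ)) (a b : Fin k) :
    comp Γ i p b a = -comp Γ i p a b := h.2 p.1 p.2 i a b

lemma contDiff_curvST (h : IsSmoothConn Γ) (i j : Fin n) : ContDiff ℝ ∞ (curvST Γ i j) :=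
  contDiff_curvD (contDiff_comp h i) (contDiff_comp h j) _ _

lemma contDiff_velST (h : IsSmoothConn Γ) (j : Fin n) : ContDiff ℝ ∞ (velST Γ j) :=
  contDiff_dirD (contDiff_comp h j) _

lemma contDiff_energyST (h : IsSmoothConn Γ) : ContDiff ℝ ∞ (energyST Γ) :=
  ContDiff.sum fun i _ => ContDiff.sum fun j _ =>
    contDiff_minner (contDiff_curvST h i j) (contDiff_curvST h i j)

lemma contDiff_momST (h : IsSmoothConn Γ) (i : Fin n) : ContDiff ℝ ∞ (momST Γ i) :=
  ContDiff.sum fun j _ => contDiff_minner (contDiff_curvST h i j) (contDiff_velST h j)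

lemma contDiff_contrST (h : IsSmoothConn Γ) (i l : Fin n) : ContDiff ℝ ∞ (contrST Γ i l) :=
  ContDiff.sum fun j _ => contDiff_minner (contDiff_curvST h i j) (contDiff_curvST h l j)

lemma pd_slice {L : Type*} [NormedAddCommGroup L] [NormedSpace ℝ L]
    {f : ℝ × (Fin n → ℝ) → L} (hf : ContDiff ℝ ∞ f) (t : ℝ) (x : Fin n → ℝ) (i : Fin n) :
    pd (fun y => f (t, y)) x i = dirD (ex i) f (t, x) := by
  have h := ((hf.differentiable (by simp) (t, x)).hasFDerivAt).comp x
    ((hasFDerivAt_const t x).prodMk (hasFDerivAt_id x))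
  unfold pd dirD
  exact congrArg (fun l : (Fin n → ℝ) →L[ℝ] L => l (Pi.single i 1)) h.fderiv

lemma curv_eq (h : IsSmoothConn Γ) (t : ℝ) (x : Fin n → ℝ) (i j : Fin n) :
    curv Γ t x i j = curvST Γ i j (t, x) := by
  unfold curv curvST curvD
  rw [← pd_slice (contDiff_comp h i), ← pd_slice (contDiff_comp h j)]
  rfl

lemma normF2_eq (h : IsSmoothConn Γ) (t : ℝ) (x : Fin n → ℝ) :
    normF2 Γ t x = energyST Γ (t, x) := by
  simp only [normF2, energyST, curv_eq h, msq]

lemma hasDerivAt_time {L : Type*} [NormedAddCommGroup L] [NormedSpace ℝ L]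
    {f : ℝ × (Fin n → ℝ) → L} (hf : ContDiff ℝ ∞ f) (t : ℝ) (x : Fin n → ℝ) :
    HasDerivAt (fun s => f (s, x)) (dirD et f (t, x)) t :=
  hasDerivAt_dirD hf ((hasDerivAt_id t).prodMk (hasDerivAt_const t x))

lemma velST_eq (h : IsSmoothConn Γ) (hflow : IsYMFlowOn Γ (Icc (-1) 1)) {t : ℝ}
    (ht : t ∈ Icc (-1 : ℝ) 1) (x : Fin n → ℝ) (j : Fin n) :
    velST Γ j (t, x) = ∑ i, cov (ex i) (comp Γ i) (curvST Γ i j) (t, x) := by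
  have h1 := hflow t ht x j
  have h2 : tderiv Γ t x j = velST Γ j (t, x) :=
    (hasDerivAt_time (contDiff_comp h j) t x).deriv
  rw [← h2, h1]
  refine Finset.sum_congr rfl fun i _ => ?_
  unfold covD cov
  simp only [curv_eq h]
  rw [pd_slice (contDiff_curvST h i j)]
  rfl

lemma curvST_antisymm (i j : Fin n) (p : ℝ × (Fin n → ℝ)) :
    curvST Γ i j p = -curvST Γ j i p := curvD_antisymm _ _ _ _ _

lemma sum_contrST (p : ℝ × (Fin n → ℝ)) : ∑ i, contrST Γ i i p = energyST Γ p := rfl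

/-- The derivative of `|F|²` in a direction in which the covariant derivative of the curvature
is an exterior covariant derivative. -/
lemma dirD_energyST (h : IsSmoothConn Γ) {v : ℝ × (Fin n → ℝ)} {a : ℝ × (Fin n → ℝ) → Mat k}
    (ha : ∀ p i j, a p j i = -a p i j) {p : ℝ × (Fin n → ℝ)} {X : Fin n → Fin n → Mat k}
    (hX : ∀ i j, cov v a (curvST Γ i j) p = X i j - X j i) :
    dirD v (energyST Γ) p = 4 * ∑ i, ∑ j, minner (X i j) (curvST Γ i j p) := by
  have h1 : dirD v (energyST Γ) p =
      ∑ i, ∑ j, (2 * minner (X i j) (curvST Γ i j p) + 2 * minner (X j i) (curvST Γ j i p)) := by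
    unfold energyST
    rw [dirD_sum _ fun i => ContDiff.sum fun j _ =>
      contDiff_minner (contDiff_curvST h i j) (contDiff_curvST h i j)]
    refine Finset.sum_congr rfl fun i _ => ?_
    rw [dirD_sum _ fun j => contDiff_minner (contDiff_curvST h i j) (contDiff_curvST h i j)]
    refine Finset.sum_congr rfl fun j _ => ?_
    rw [dirD_minner_cov ha (contDiff_curvST h i j) (contDiff_curvST h i j), hX,
      minner_comm (curvST Γ i j p) (X i j - X j i), curvST_antisymm j i p]
    simp only [← innL_apply, map_sub, sub_apply, map_neg]
    ring
  rw [h1]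
  simp only [Finset.sum_add_distrib, ← Finset.mul_sum]
  rw [Finset.sum_comm (f := fun i j => minner (X j i) (curvST Γ j i p))]
  ring

lemma cov_neg (v : ℝ × (Fin n → ℝ)) (a f : ℝ × (Fin n → ℝ) → Mat k) (p : ℝ × (Fin n → ℝ)) :
    cov v a (fun q => -f q) p = -cov v a f p := by
  unfold cov dirD
  rw [fderiv_fun_neg]
  simp only [← braL_apply, map_neg, neg_apply]
  abel

lemma dirD_zero_fun (v p : ℝ × (Fin n → ℝ)) :
    dirD v (fun _ => (0 : Mat k)) p = 0 := by
  simp [dirD]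

lemma dirD_et_energyST (h : IsSmoothConn Γ) (p : ℝ × (Fin n → ℝ)) :
    dirD et (energyST Γ) p =
      4 * ∑ i, ∑ j, minner (cov (ex i) (comp Γ i) (velST Γ j) p) (curvST Γ i j p) := by
  refine dirD_energyST h (a := fun _ => 0) (by simp) fun i j => ?_
  have hb := bianchi (contDiff_const (c := (0 : Mat k))) (contDiff_comp h i) (contDiff_comp h j)
    et (ex i) (ex j) p
  have h1 : curvD (ex j) et (comp Γ j) (fun _ => 0) = fun q => -velST Γ j q := by
    funext q
    rw [curvD, dirD_zero_fun, ← braL_apply, map_zero, velST]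
    abel
  have h2 : curvD et (ex i) (fun _ => 0) (comp Γ i) = velST Γ i := by
    funext q
    rw [curvD, dirD_zero_fun, ← braL_apply, map_zero, zero_apply, velST]
    abel
  rw [h1, h2, cov_neg] at hb
  rw [← sub_eq_zero]
  refine Eq.trans ?_ hb
  unfold curvST
  abel

lemma sum_dirD_momST (h : IsSmoothConn Γ) (hflow : IsYMFlowOn Γ (Icc (-1) 1)) {t : ℝ}
    (ht : t ∈ Icc (-1 : ℝ) 1) (x : Fin n → ℝ) :
    ∑ i, dirD (ex i) (momST Γ i) (t, x) =
      ∑ j, msq (velST Γ j (t, x)) + 1 / 4 * dirD et (energyST Γ) (t, x) := by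
  have h1 (i : Fin n) : dirD (ex i) (momST Γ i) (t, x) =
      ∑ j, minner (cov (ex i) (comp Γ i) (curvST Γ i j) (t, x)) (velST Γ j (t, x)) +
      ∑ j, minner (cov (ex i) (comp Γ i) (velST Γ j) (t, x)) (curvST Γ i j (t, x)) := by
    unfold momST
    rw [dirD_sum _ fun j => contDiff_minner (contDiff_curvST h i j) (contDiff_velST h j),
      ← Finset.sum_add_distrib]
    refine Finset.sum_congr rfl fun j _ => ?_
    rw [dirD_minner_cov (comp_skew h i) (contDiff_curvST h i j) (contDiff_velST h j),
      minner_comm (curvST Γ i j (t, x))]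
  simp only [h1, Finset.sum_add_distrib]
  rw [dirD_et_energyST h, Finset.sum_comm]
  have h2 (j : Fin n) :
      ∑ i, minner (cov (ex i) (comp Γ i) (curvST Γ i j) (t, x)) (velST Γ j (t, x)) =
        msq (velST Γ j (t, x)) := by
    unfold msq
    conv_rhs => rw [← innL_apply]; enter [1]; rw [velST_eq h hflow ht]
    rw [map_sum, sum_apply]
    rfl
  simp only [h2]
  ring

lemma sum_dirD_contrST (h : IsSmoothConn Γ) (hflow : IsYMFlowOn Γ (Icc (-1) 1)) {t : ℝ}
    (ht : t ∈ Icc (-1 : ℝ) 1) (x : Fin n → ℝ) (l : Fin n) :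
    ∑ i, dirD (ex i) (contrST Γ i l) (t, x) =
      momST Γ l (t, x) + 1 / 4 * dirD (ex l) (energyST Γ) (t, x) := by
  have h1 (i : Fin n) : dirD (ex i) (contrST Γ i l) (t, x) =
      ∑ j, minner (cov (ex i) (comp Γ i) (curvST Γ i j) (t, x)) (curvST Γ l j (t, x)) +
      ∑ j, minner (cov (ex i) (comp Γ i) (curvST Γ l j) (t, x)) (curvST Γ i j (t, x)) := by
    unfold contrST
    rw [dirD_sum _ fun j => contDiff_minner (contDiff_curvST h i j) (contDiff_curvST h l j),
      ← Finset.sum_add_distrib]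
    refine Finset.sum_congr rfl fun j _ => ?_
    rw [dirD_minner_cov (comp_skew h i) (contDiff_curvST h i j) (contDiff_curvST h l j),
      minner_comm (curvST Γ i j (t, x))]
  have h2 (j : Fin n) :
      ∑ i, minner (cov (ex i) (comp Γ i) (curvST Γ i j) (t, x)) (curvST Γ l j (t, x)) =
        minner (curvST Γ l j (t, x)) (velST Γ j (t, x)) := by
    rw [minner_comm, velST_eq h hflow ht, ← innL_apply, map_sum, sum_apply]
    rfl
  have h3 (i j : Fin n) : cov (ex l) (comp Γ l) (curvST Γ i j) (t, x) =
      cov (ex i) (comp Γ i) (curvST Γ l j) (t, x) -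
        cov (ex j) (comp Γ j) (curvST Γ l i) (t, x) := by
    have hb := bianchi (contDiff_comp h l) (contDiff_comp h i) (contDiff_comp h j)
      (ex l) (ex i) (ex j) (t, x)
    have h4 : curvD (ex j) (ex l) (comp Γ j) (comp Γ l) = fun q => -curvST Γ l j q :=
      funext fun q => curvST_antisymm j l q
    rw [h4, cov_neg] at hb
    rw [← sub_eq_zero, ← hb]
    unfold curvST
    abel
  rw [dirD_energyST h (comp_skew h l) h3]
  simp only [h1, Finset.sum_add_distrib]
  rw [Finset.sum_comm]
  simp only [h2, momST]
  ring

end Pointwise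

/-! ### Integration lemmas -/

lemma integral_lineDeriv_eq_zero {n : ℕ} {f f' : (Fin n → ℝ) → ℝ} {v : Fin n → ℝ}
    (hf : Integrable f) (hf' : Integrable f') (hd : ∀ x, HasLineDerivAt ℝ f (f' x) x v) :
    ∫ x, f' x = 0 := by
  have h := integral_bilinear_hasLineDerivAt_right_eq_neg_left_of_integrable (μ := volume)
    (f := f) (f' := f') (g := fun _ => (1 : ℝ)) (g' := fun _ => 0) (v := v)
    (B := ContinuousLinearMap.mul ℝ ℝ) (by simpa using hf') (by simp) (by simpa using hf)
    (fun x _ => hd x) (fun x _ => by simpa [HasLineDerivAt] using hasDerivAt_const (0 : ℝ) (1 : ℝ))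
  simpa using h.symm

lemma integrable_of_vanish {n : ℕ} {f : (Fin n → ℝ) → ℝ} {K : Set (Fin n → ℝ)}
    (hK : IsCompact K) (hf : Continuous f) (h0 : ∀ x, x ∉ K → f x = 0) : Integrable f :=
  hf.integrable_of_hasCompactSupport (HasCompactSupport.intro hK h0)

/-- Differentiation under the integral sign for uniformly compactly supported integrands. -/
lemma hasDerivAt_integral_of_vanish {n : ℕ} {K : Set (Fin n → ℝ)} (hK : IsCompact K) {T t : ℝ}
    (ht : t < T) {q q' : ℝ → (Fin n → ℝ) → ℝ} (hq : ∀ s < T, Continuous (q s))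
    (hq' : ContinuousOn (Function.uncurry q') (Iio T ×ˢ univ))
    (hd : ∀ s < T, ∀ x, HasDerivAt (fun r => q r x) (q' s x) s)
    (h0 : ∀ s x, x ∉ K → q s x = 0) (h0' : ∀ s x, x ∉ K → q' s x = 0) :
    HasDerivAt (fun s => ∫ x, q s x) (∫ x, q' t x) t := by
  obtain ⟨ε, hε, hεT⟩ : ∃ ε > 0, t + ε < T := ⟨(T - t) / 2, by linarith, by linarith⟩
  have hsub : Icc (t - ε) (t + ε) ×ˢ K ⊆ Iio T ×ˢ univ :=
    prod_mono (fun s hs => lt_of_le_of_lt hs.2 hεT) (subset_univ _)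
  obtain ⟨C, hC⟩ := (isCompact_Icc.prod hK).exists_bound_of_continuousOn (hq'.mono hsub)
  have hslice (s : ℝ) (hs : s < T) : Continuous (q' s) := by
    have := hq'.comp_continuous (f := fun x : Fin n → ℝ => (s, x)) (by fun_prop)
      (fun x => ⟨hs, mem_univ _⟩)
    exact this
  refine (hasDerivAt_integral_of_dominated_loc_of_deriv_le (s := Icc (t - ε) (t + ε))
    (bound := K.indicator fun _ => C) (Icc_mem_nhds (by linarith) (by linarith))
    ?_ (integrable_of_vanish hK (hq t ht) (h0 t)) (hslice t ht).aestronglyMeasurable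
    (ae_of_all _ fun x s hs => ?_) ?_ (ae_of_all _ fun x s hs => ?_)).2
  · filter_upwards [Iio_mem_nhds ht] with s hs using (hq s hs).aestronglyMeasurable
  · by_cases hx : x ∈ K
    · rw [indicator_of_mem hx]
      exact hC (s, x) ⟨hs, hx⟩
    · rw [indicator_of_notMem hx, h0' s x hx, norm_zero]
  · exact (integrable_indicator_iff hK.measurableSet).2 (integrableOn_const hK.measure_ne_top)
  · exact hd s (lt_of_le_of_lt hs.2 hεT) x

/-! ### The Gaussian weight -/

/-- The weight `τ² G` with `τ = T - t`, up to the factor `(4π)^{-n/2}`. -/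
def wt {n : ℕ} (x0 : Fin n → ℝ) (T t : ℝ) (x : Fin n → ℝ) : ℝ :=
  (T - t) ^ (2 - (n : ℝ) / 2) * Real.exp (-(∑ i, (x i - x0 i) ^ 2) / (4 * (T - t)))

section Weight

variable {n : ℕ} (x0 : Fin n → ℝ) {T t : ℝ}

lemma wt_nonneg (ht : t < T) (x : Fin n → ℝ) : 0 ≤ wt x0 T t x :=
  mul_nonneg (Real.rpow_nonneg (by linarith) _) (Real.exp_pos _).le

lemma continuousOn_wt :
    ContinuousOn (fun p : ℝ × (Fin n → ℝ) => wt x0 T p.1 p.2) (Iio T ×ˢ univ) := by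
  unfold wt
  have h (p : ℝ × (Fin n → ℝ)) (hp : p ∈ Iio T ×ˢ (univ : Set (Fin n → ℝ))) : 0 < T - p.1 :=
    sub_pos.2 hp.1
  refine ContinuousOn.mul (ContinuousOn.rpow_const (by fun_prop) fun p hp => Or.inl (h p hp).ne') ?_
  refine Real.continuous_exp.comp_continuousOn (ContinuousOn.div (by fun_prop) (by fun_prop) ?_)
  intro p hp
  have := h p hp
  positivity

lemma continuous_wt : Continuous (wt x0 T t) := by
  unfold wt
  fun_prop

lemma hasDerivAt_wt_time (ht : t < T) (x : Fin n → ℝ) :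
    HasDerivAt (fun s => wt x0 T s x)
      (-((2 - (n : ℝ) / 2) / (T - t) + (∑ i, (x i - x0 i) ^ 2) / (4 * (T - t) ^ 2))
        * wt x0 T t x) t := by
  have hτ : 0 < T - t := sub_pos.2 ht
  have h1 : HasDerivAt (fun s => T - s) (-1) t := by simpa using (hasDerivAt_id t).const_sub T
  have h2 := h1.rpow_const (p := 2 - (n : ℝ) / 2) (Or.inl hτ.ne')
  have h3 := ((hasDerivAt_const t (-(∑ i, (x i - x0 i) ^ 2))).fun_div (h1.const_mul 4)
    (by positivity)).exp
  refine (h2.fun_mul h3).congr_deriv ?_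
  unfold wt
  rw [Real.rpow_sub_one hτ.ne']
  field_simp
  ring

lemma hasDerivAt_coord (x : Fin n → ℝ) (i j : Fin n) :
    HasDerivAt (fun s : ℝ => (x + s • Pi.single i (1 : ℝ) : Fin n → ℝ) j - x0 j)
      ((Pi.single i (1 : ℝ) : Fin n → ℝ) j) 0 := by
  simpa using (((hasDerivAt_id (0 : ℝ)).mul_const
    ((Pi.single i (1 : ℝ) : Fin n → ℝ) j)).const_add (x j)).sub_const (x0 j)

lemma hasDerivAt_wt_space (x : Fin n → ℝ) (i : Fin n) :
    HasDerivAt (fun s : ℝ => wt x0 T t (x + s • Pi.single i 1))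
      (-((x i - x0 i) / (2 * (T - t))) * wt x0 T t x) 0 := by
  have h1 := hasDerivAt_coord x0 x i
  have h2 := ((HasDerivAt.fun_sum fun j (_ : j ∈ Finset.univ) => (h1 j).fun_pow 2).fun_neg.div_const
    (4 * (T - t))).exp.const_mul ((T - t) ^ (2 - (n : ℝ) / 2))
  refine h2.congr_deriv ?_
  simp only [wt, Pi.single_apply]
  generalize T - t = τ
  simp
  ring

end Weight

/-! ### Monotonicity of the weighted energy -/

section Monotonicity

variable {n k : ℕ} {Γ : Conn n k}

lemma dirD_eq_zero_of_vanish {L : Type*} [NormedAddCommGroup L] [NormedSpace ℝ L]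
    {f : ℝ × (Fin n → ℝ) → L} {K : Set (Fin n → ℝ)} (hK : IsCompact K)
    (h0 : ∀ t x, x ∉ K → f (t, x) = 0) (v : ℝ × (Fin n → ℝ)) (t : ℝ) (x : Fin n → ℝ)
    (hx : x ∉ K) : dirD v f (t, x) = 0 := by
  have hev : f =ᶠ[nhds (t, x)] fun _ => 0 := by
    filter_upwards [(hK.isClosed.isOpen_compl.preimage continuous_snd).mem_nhds
      (show (t, x) ∈ Prod.snd ⁻¹' Kᶜ from hx)] with p hp using h0 p.1 p.2 hp
  unfold dirD
  rw [hev.fderiv_eq]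
  simp

lemma curvST_eq_zero {K : Set (Fin n → ℝ)} (hK : IsCompact K) (hs : SuppIn Γ K) (i j : Fin n)
    (t : ℝ) (x : Fin n → ℝ) (hx : x ∉ K) : curvST Γ i j (t, x) = 0 := by
  have h (i : Fin n) (t : ℝ) (x : Fin n → ℝ) (hx : x ∉ K) : comp Γ i (t, x) = 0 := by
    simp [comp, hs t x hx]
  unfold curvST curvD
  rw [dirD_eq_zero_of_vanish hK (h i) _ t x hx, dirD_eq_zero_of_vanish hK (h j) _ t x hx,
    h i t x hx, ← braL_apply]
  simp

lemma energyST_eq_zero {K : Set (Fin n → ℝ)} (hK : IsCompact K) (hs : SuppIn Γ K)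
    (t : ℝ) (x : Fin n → ℝ) (hx : x ∉ K) : energyST Γ (t, x) = 0 := by
  simp [energyST, curvST_eq_zero hK hs _ _ t x hx, ← innL_apply]

lemma momST_eq_zero {K : Set (Fin n → ℝ)} (hK : IsCompact K) (hs : SuppIn Γ K) (i : Fin n)
    (t : ℝ) (x : Fin n → ℝ) (hx : x ∉ K) : momST Γ i (t, x) = 0 := by
  simp [momST, curvST_eq_zero hK hs _ _ t x hx, ← innL_apply]

lemma contrST_eq_zero {K : Set (Fin n → ℝ)} (hK : IsCompact K) (hs : SuppIn Γ K) (i l : Fin n)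
    (t : ℝ) (x : Fin n → ℝ) (hx : x ∉ K) : contrST Γ i l (t, x) = 0 := by
  simp [contrST, curvST_eq_zero hK hs _ _ t x hx, ← innL_apply]

/-- The vector field whose divergence is discarded in the monotonicity formula. -/
def flux (Γ : Conn n k) (x0 : Fin n → ℝ) (T t : ℝ) (i : Fin n) (x : Fin n → ℝ) : ℝ :=
  wt x0 T t x * (4 * momST Γ i (t, x)
    - 2 / (T - t) * ∑ l, (x l - x0 l) * contrST Γ i l (t, x)
    + 1 / (2 * (T - t)) * ((x i - x0 i) * energyST Γ (t, x)))

/-- The derivative of `flux Γ x0 T t i` in the `i`-th coordinate direction. -/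
def fluxD (Γ : Conn n k) (x0 : Fin n → ℝ) (T t : ℝ) (i : Fin n) (x : Fin n → ℝ) : ℝ :=
  -((x i - x0 i) / (2 * (T - t))) * flux Γ x0 T t i x +
    wt x0 T t x * (4 * dirD (ex i) (momST Γ i) (t, x)
      - 2 / (T - t) * (contrST Γ i i (t, x)
        + ∑ l, (x l - x0 l) * dirD (ex i) (contrST Γ i l) (t, x))
      + 1 / (2 * (T - t)) * (energyST Γ (t, x)
        + (x i - x0 i) * dirD (ex i) (energyST Γ) (t, x)))

lemma hasDerivAt_space {L : Type*} [NormedAddCommGroup L] [NormedSpace ℝ L]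
    {f : ℝ × (Fin n → ℝ) → L} (hf : ContDiff ℝ ∞ f) (t : ℝ) (x : Fin n → ℝ) (i : Fin n) :
    HasDerivAt (fun s : ℝ => f (t, x + s • Pi.single i 1)) (dirD (ex i) f (t, x)) 0 := by
  have h : HasDerivAt (fun s : ℝ => (t, x + s • (Pi.single i 1 : Fin n → ℝ))) (ex i) 0 := by
    refine (hasDerivAt_const (0 : ℝ) t).prodMk ?_
    simpa using ((hasDerivAt_id (0 : ℝ)).smul_const (Pi.single i 1 : Fin n → ℝ)).const_add x
  simpa using hasDerivAt_dirD hf h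

lemma hasLineDerivAt_flux (h : IsSmoothConn Γ) (x0 : Fin n → ℝ) (T t : ℝ) (i : Fin n)
    (x : Fin n → ℝ) :
    HasLineDerivAt ℝ (flux Γ x0 T t i) (fluxD Γ x0 T t i x) x (Pi.single i 1) := by
  have h1 := hasDerivAt_coord x0 x i
  have hS := HasDerivAt.fun_sum fun l (_ : l ∈ Finset.univ) =>
    (h1 l).fun_mul (hasDerivAt_space (contDiff_contrST h i l) t x i)
  have hE := (h1 i).fun_mul (hasDerivAt_space (contDiff_energyST h) t x i)
  have hP := hasDerivAt_space (contDiff_momST h i) t x i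
  have hall := (hasDerivAt_wt_space x0 (T := T) (t := t) x i).fun_mul
    (((hP.const_mul 4).fun_sub (hS.const_mul (2 / (T - t)))).fun_add
      (hE.const_mul (1 / (2 * (T - t)))))
  refine HasDerivAt.congr_deriv hall ?_
  simp [flux, fluxD, Pi.single_apply, Finset.sum_add_distrib]
  ring

lemma continuous_slice {f : ℝ × (Fin n → ℝ) → ℝ} (hf : ContDiff ℝ ∞ f) (t : ℝ) :
    Continuous fun x => f (t, x) := by
  have := hf.continuous
  fun_prop

lemma continuous_flux (h : IsSmoothConn Γ) (x0 : Fin n → ℝ) (T t : ℝ) (i : Fin n) :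
    Continuous (flux Γ x0 T t i) := by
  have h1 := continuous_slice (contDiff_energyST h) t
  have h2 := continuous_slice (contDiff_momST h i) t
  have h3 (l : Fin n) := continuous_slice (contDiff_contrST h i l) t
  have h4 := continuous_wt x0 (T := T) (t := t)
  unfold flux
  fun_prop

lemma continuous_fluxD (h : IsSmoothConn Γ) (x0 : Fin n → ℝ) (T t : ℝ) (i : Fin n) :
    Continuous (fluxD Γ x0 T t i) := by
  have h0 := continuous_flux h x0 T t i
  have h1 := continuous_slice (contDiff_energyST h) t
  have h2 := continuous_slice (contDiff_dirD (contDiff_momST h i) (ex i)) t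
  have h3 (l : Fin n) := continuous_slice (contDiff_contrST h i l) t
  have h4 := continuous_wt x0 (T := T) (t := t)
  have h5 (l : Fin n) := continuous_slice (contDiff_dirD (contDiff_contrST h i l) (ex i)) t
  have h6 := continuous_slice (contDiff_dirD (contDiff_energyST h) (ex i)) t
  unfold fluxD
  fun_prop

lemma flux_eq_zero {K : Set (Fin n → ℝ)} (hK : IsCompact K) (hs : SuppIn Γ K) (x0 : Fin n → ℝ)
    (T t : ℝ) (i : Fin n) (x : Fin n → ℝ) (hx : x ∉ K) : flux Γ x0 T t i x = 0 := by
  simp [flux, energyST_eq_zero hK hs t x hx, momST_eq_zero hK hs _ t x hx,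
    contrST_eq_zero hK hs _ _ t x hx]

lemma fluxD_eq_zero {K : Set (Fin n → ℝ)} (hK : IsCompact K) (hs : SuppIn Γ K) (x0 : Fin n → ℝ)
    (T t : ℝ) (i : Fin n) (x : Fin n → ℝ) (hx : x ∉ K) : fluxD Γ x0 T t i x = 0 := by
  simp [fluxD, flux_eq_zero hK hs x0 T t i x hx, energyST_eq_zero hK hs t x hx,
    contrST_eq_zero hK hs _ _ t x hx,
    dirD_eq_zero_of_vanish hK (momST_eq_zero hK hs i) _ t x hx,
    dirD_eq_zero_of_vanish hK (energyST_eq_zero hK hs) _ t x hx,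
    dirD_eq_zero_of_vanish hK (contrST_eq_zero hK hs i _) _ t x hx]

lemma integrable_fluxD (h : IsSmoothConn Γ) {K : Set (Fin n → ℝ)} (hK : IsCompact K)
    (hs : SuppIn Γ K) (x0 : Fin n → ℝ) (T t : ℝ) (i : Fin n) :
    Integrable (fluxD Γ x0 T t i) :=
  integrable_of_vanish hK (continuous_fluxD h x0 T t i) (fluxD_eq_zero hK hs x0 T t i)

lemma integral_fluxD (h : IsSmoothConn Γ) {K : Set (Fin n → ℝ)} (hK : IsCompact K)
    (hs : SuppIn Γ K) (x0 : Fin n → ℝ) (T t : ℝ) (i : Fin n) :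
    ∫ x, fluxD Γ x0 T t i x = 0 :=
  integral_lineDeriv_eq_zero
    (integrable_of_vanish hK (continuous_flux h x0 T t i) (flux_eq_zero hK hs x0 T t i))
    (integrable_fluxD h hK hs x0 T t i) (hasLineDerivAt_flux h x0 T t i)

/-- Time derivative of the weighted energy density. -/
def densD (Γ : Conn n k) (x0 : Fin n → ℝ) (T t : ℝ) (x : Fin n → ℝ) : ℝ :=
  dirD et (energyST Γ) (t, x) * wt x0 T t x + energyST Γ (t, x) *
    (-((2 - (n : ℝ) / 2) / (T - t) + (∑ i, (x i - x0 i) ^ 2) / (4 * (T - t) ^ 2)) * wt x0 T t x)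

/-- The square `∑ⱼ |2 ∂_tΓⱼ - τ⁻¹ ∑ᵢ yᵢ F_{ij}|²`, expanded. -/
lemma soliton_expand (t c : ℝ) (x y : Fin n → ℝ) :
    ∑ j, msq ((2 : ℝ) • velST Γ j (t, x) - c • ∑ i, y i • curvST Γ i j (t, x)) =
      4 * ∑ j, msq (velST Γ j (t, x)) - 4 * c * ∑ i, y i * momST Γ i (t, x)
        + c ^ 2 * ∑ i, ∑ l, y i * y l * contrST Γ i l (t, x) := by
  have h1 (j : Fin n) : msq ((2 : ℝ) • velST Γ j (t, x) - c • ∑ i, y i • curvST Γ i j (t, x)) =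
      4 * msq (velST Γ j (t, x))
        - 4 * c * ∑ i, y i * minner (curvST Γ i j (t, x)) (velST Γ j (t, x))
        + c ^ 2 * ∑ i, ∑ l, y i * y l * minner (curvST Γ i j (t, x)) (curvST Γ l j (t, x)) := by
    have h2 : minner (velST Γ j (t, x)) (∑ i, y i • curvST Γ i j (t, x)) =
        ∑ i, y i * minner (curvST Γ i j (t, x)) (velST Γ j (t, x)) := by
      simp only [← innL_apply, map_sum, map_smul, smul_eq_mul]
      simp only [innL_apply, minner_comm]
    have h3 : minner (∑ i, y i • curvST Γ i j (t, x)) (∑ i, y i • curvST Γ i j (t, x)) =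
        ∑ i, ∑ l, y i * y l * minner (curvST Γ i j (t, x)) (curvST Γ l j (t, x)) := by
      simp only [← innL_apply, map_sum, map_smul, smul_eq_mul, sum_apply, smul_apply,
        Finset.mul_sum, mul_assoc]
      rw [Finset.sum_comm]
      refine Finset.sum_congr rfl fun i _ => Finset.sum_congr rfl fun l _ => ?_
      ring
    have h4 (A B : Mat k) :
        msq ((2 : ℝ) • A - c • B) = 4 * msq A - 4 * c * minner A B + c ^ 2 * minner B B := by
      have := minner_comm A B
      simp only [msq, ← innL_apply, map_sub, map_smul, sub_apply, smul_apply, smul_eq_mul] at this ⊢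
      linear_combination (2 * c) * this
    rw [h4, h2, h3]
  simp only [h1, Finset.sum_add_distrib, Finset.sum_sub_distrib, ← Finset.mul_sum]
  congr 2
  · rw [Finset.sum_comm]
    simp only [momST, Finset.mul_sum]
  · rw [Finset.sum_comm]
    simp only [contrST, Finset.mul_sum]
    exact Finset.sum_congr rfl fun i _ => Finset.sum_comm

lemma densD_sub_flux (h : IsSmoothConn Γ) (hflow : IsYMFlowOn Γ (Icc (-1) 1)) {t : ℝ}
    (ht : t ∈ Icc (-1 : ℝ) 1) (x0 : Fin n → ℝ) {T : ℝ} (hT : t < T) (x : Fin n → ℝ) :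
    densD Γ x0 T t x - ∑ i, fluxD Γ x0 T t i x = -(wt x0 T t x *
      ∑ j, msq ((2 : ℝ) • velST Γ j (t, x)
        - (1 / (T - t)) • ∑ i, (x i - x0 i) • curvST Γ i j (t, x))) := by
  have hτ : T - t ≠ 0 := (sub_pos.2 hT).ne'
  rw [soliton_expand]
  have hM := sum_dirD_momST h hflow ht x
  have hS : ∑ i, ∑ l, (x l - x0 l) * dirD (ex i) (contrST Γ i l) (t, x) =
      ∑ l, (x l - x0 l) * momST Γ l (t, x)
        + 1 / 4 * ∑ l, (x l - x0 l) * dirD (ex l) (energyST Γ) (t, x) := by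
    rw [Finset.sum_comm]
    simp only [← Finset.mul_sum, sum_dirD_contrST h hflow ht, mul_add, Finset.sum_add_distrib]
    congr 1
    rw [Finset.mul_sum]
    exact Finset.sum_congr rfl fun l _ => by ring
  have hterm (i : Fin n) : fluxD Γ x0 T t i x = wt x0 T t x *
      (4 * dirD (ex i) (momST Γ i) (t, x)
        - 2 / (T - t) * ((x i - x0 i) * momST Γ i (t, x))
        + 1 / (T - t) ^ 2 * (∑ l, (x i - x0 i) * (x l - x0 l) * contrST Γ i l (t, x))
        - energyST Γ (t, x) / (4 * (T - t) ^ 2) * (x i - x0 i) ^ 2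
        - 2 / (T - t) * contrST Γ i i (t, x)
        - 2 / (T - t) * ∑ l, (x l - x0 l) * dirD (ex i) (contrST Γ i l) (t, x)
        + 1 / (2 * (T - t)) * energyST Γ (t, x)
        + 1 / (2 * (T - t)) * ((x i - x0 i) * dirD (ex i) (energyST Γ) (t, x))) := by
    simp only [mul_assoc, ← Finset.mul_sum]
    unfold fluxD flux
    field_simp
    ring
  simp only [hterm, ← Finset.mul_sum, Finset.sum_add_distrib, Finset.sum_sub_distrib, hM, hS,
    sum_contrST, Finset.sum_const, Finset.card_univ, Fintype.card_fin, nsmul_eq_mul]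
  unfold densD
  generalize ∑ i, ∑ l, (x i - x0 i) * (x l - x0 l) * contrST Γ i l (t, x) = S
  field_simp
  ring

lemma continuousOn_densD (h : IsSmoothConn Γ) (x0 : Fin n → ℝ) (T : ℝ) :
    ContinuousOn (Function.uncurry (densD Γ x0 T)) (Iio T ×ˢ univ) := by
  have h1 := (contDiff_energyST h).continuous
  have h2 := (contDiff_dirD (contDiff_energyST h) et).continuous
  have h3 := continuousOn_wt x0 (T := T)
  have h4 (p : ℝ × (Fin n → ℝ)) (hp : p ∈ Iio T ×ˢ (univ : Set (Fin n → ℝ))) : T - p.1 ≠ 0 :=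
    (sub_pos.2 hp.1).ne'
  have h5 : ContinuousOn (fun p : ℝ × (Fin n → ℝ) => (2 - (n : ℝ) / 2) / (T - p.1))
      (Iio T ×ˢ univ) := ContinuousOn.div (by fun_prop) (by fun_prop) h4
  have h6 : ContinuousOn (fun p : ℝ × (Fin n → ℝ) =>
      (∑ i, (p.2 i - x0 i) ^ 2) / (4 * (T - p.1) ^ 2)) (Iio T ×ˢ univ) :=
    ContinuousOn.div (by fun_prop) (by fun_prop) fun p hp => by have := h4 p hp; positivity
  exact (h2.continuousOn.mul h3).add (h1.continuousOn.mul ((h5.add h6).neg.mul h3))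

/-- The weighted energy. -/
def wEnergy (Γ : Conn n k) (x0 : Fin n → ℝ) (T t : ℝ) : ℝ :=
  ∫ x, energyST Γ (t, x) * wt x0 T t x

lemma hasDerivAt_wEnergy (h : IsSmoothConn Γ) {K : Set (Fin n → ℝ)} (hK : IsCompact K)
    (hs : SuppIn Γ K) (x0 : Fin n → ℝ) {T t : ℝ} (hT : t < T) :
    HasDerivAt (wEnergy Γ x0 T) (∫ x, densD Γ x0 T t x) t := by
  refine hasDerivAt_integral_of_vanish hK hT
    (fun s _ => (continuous_slice (contDiff_energyST h) s).mul (continuous_wt x0))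
    (continuousOn_densD h x0 T)
    (fun s hs x => (hasDerivAt_time (contDiff_energyST h) s x).fun_mul (hasDerivAt_wt_time x0 hs x))
    (fun s x hx => by simp [energyST_eq_zero hK hs s x hx])
    (fun s x hx => ?_)
  simp [densD, energyST_eq_zero hK hs s x hx,
    dirD_eq_zero_of_vanish hK (energyST_eq_zero hK hs) _ s x hx]

lemma integral_densD_nonpos (h : IsSmoothConn Γ) (hflow : IsYMFlowOn Γ (Icc (-1) 1))
    {K : Set (Fin n → ℝ)} (hK : IsCompact K) (hs : SuppIn Γ K) {t : ℝ}
    (ht : t ∈ Icc (-1 : ℝ) 1) (x0 : Fin n → ℝ) {T : ℝ} (hT : t < T) :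
    ∫ x, densD Γ x0 T t x ≤ 0 := by
  have hle : ∫ x, densD Γ x0 T t x ≤ ∫ x, ∑ i, fluxD Γ x0 T t i x := by
    refine integral_mono ?_ (integrable_finsetSum _ fun i _ => integrable_fluxD h hK hs x0 T t i)
      fun x => ?_
    · refine integrable_of_vanish hK ?_ fun x hx => ?_
      · exact (continuousOn_densD h x0 T).comp_continuous (f := fun x : Fin n → ℝ => (t, x))
          (by fun_prop) fun x => ⟨hT, mem_univ _⟩
      · simp [densD, energyST_eq_zero hK hs t x hx,
          dirD_eq_zero_of_vanish hK (energyST_eq_zero hK hs) _ t x hx]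
    · have h1 := densD_sub_flux h hflow ht x0 hT x
      have h2 := mul_nonneg (wt_nonneg x0 hT x) (Finset.sum_nonneg
        fun j (_ : j ∈ Finset.univ) => msq_nonneg ((2 : ℝ) • velST Γ j (t, x)
          - (1 / (T - t)) • ∑ i, (x i - x0 i) • curvST Γ i j (t, x)))
      dsimp only
      linarith
  refine hle.trans_eq ?_
  rw [integral_finsetSum _ fun i _ => integrable_fluxD h hK hs x0 T t i]
  simp [integral_fluxD h hK hs]

/-- Monotonicity formula for the Yang–Mills flow. -/
lemma wEnergy_le (h : IsSmoothConn Γ) (hflow : IsYMFlowOn Γ (Icc (-1) 1))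
    {K : Set (Fin n → ℝ)} (hK : IsCompact K) (hs : SuppIn Γ K) {t : ℝ}
    (ht : t ∈ Icc (-1 : ℝ) 1) (x0 : Fin n → ℝ) {T : ℝ} (hT : t < T) :
    wEnergy Γ x0 T t ≤ wEnergy Γ x0 T (-1) := by
  have hd (s : ℝ) (hs' : s ≤ t) := hasDerivAt_wEnergy h hK hs x0 (hs'.trans_lt hT)
  refine antitoneOn_of_deriv_nonpos (convex_Icc (-1) t)
    (fun s hs' => (hd s hs'.2).continuousAt.continuousWithinAt)
    (fun s hs' => (hd s (interior_subset hs').2).differentiableAt.differentiableWithinAt)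
    (fun s hs' => ?_) (left_mem_Icc.2 ht.1) (right_mem_Icc.2 ht.1) ht.1
  have hs'' := interior_subset hs'
  rw [(hd s hs''.2).deriv]
  exact integral_densD_nonpos h hflow hK hs ⟨hs''.1, hs''.2.trans ht.2⟩ x0 (hs''.2.trans_lt hT)

end Monotonicity

/-! ### Energy bounds -/

section EnergyBound

variable {n k : ℕ} {Γ : Conn n k}

lemma energyST_nonneg (p : ℝ × (Fin n → ℝ)) : 0 ≤ energyST Γ p :=
  Finset.sum_nonneg fun _ _ => Finset.sum_nonneg fun _ _ => msq_nonneg _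

lemma wt_le {x0 : Fin n → ℝ} {T : ℝ} (hT : T ∈ Icc (-(1 / 2) : ℝ) (1 / 8)) (x : Fin n → ℝ) :
    wt x0 T (-1) x ≤ 2 * 2 ^ ((n : ℝ) / 2) := by
  obtain ⟨h1, h2⟩ := hT
  have hτ : 0 < T - -1 := by linarith
  have hexp : Real.exp (-(∑ i, (x i - x0 i) ^ 2) / (4 * (T - -1))) ≤ 1 := by
    rw [Real.exp_le_one_iff, neg_div, neg_nonpos]
    positivity
  have hpow : (T - -1) ^ (-((n : ℝ) / 2)) ≤ 2 ^ ((n : ℝ) / 2) := by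
    rw [Real.rpow_neg hτ.le, ← Real.inv_rpow hτ.le]
    refine Real.rpow_le_rpow (by positivity) ?_ (by positivity)
    rw [inv_le_comm₀ hτ (by norm_num)]
    linarith
  unfold wt
  calc (T - -1) ^ (2 - (n : ℝ) / 2) * Real.exp (-(∑ i, (x i - x0 i) ^ 2) / (4 * (T - -1)))
      ≤ (T - -1) ^ (2 - (n : ℝ) / 2) * 1 := by gcongr
    _ = (T - -1) ^ 2 * (T - -1) ^ (-((n : ℝ) / 2)) := by
      rw [mul_one, sub_eq_add_neg (2 : ℝ), Real.rpow_add hτ, Real.rpow_two]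
    _ ≤ 2 * 2 ^ ((n : ℝ) / 2) := by
      gcongr
      nlinarith

lemma le_wt {x0 x : Fin n → ℝ} {T t r : ℝ} (hr : 0 < r) (h1 : r ^ 2 < T - t)
    (h2 : T - t < 3 * r ^ 2) (hx : ∑ i, (x i - x0 i) ^ 2 < r ^ 2) :
    r ^ 4 * ((3 * r ^ 2) ^ (-((n : ℝ) / 2)) * Real.exp (-1)) ≤ wt x0 T t x := by
  have hr2 : 0 < r ^ 2 := by positivity
  have hτ : 0 < T - t := hr2.trans h1
  have hpow : (3 * r ^ 2) ^ (-((n : ℝ) / 2)) ≤ (T - t) ^ (-((n : ℝ) / 2)) :=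
    Real.rpow_le_rpow_of_nonpos hτ h2.le (by simp; positivity)
  have hexp : -1 ≤ -(∑ i, (x i - x0 i) ^ 2) / (4 * (T - t)) := by
    rw [le_div_iff₀ (by positivity)]
    linarith
  unfold wt
  rw [sub_eq_add_neg (2 : ℝ), Real.rpow_add hτ, Real.rpow_two, mul_assoc]
  have h4 : r ^ 4 ≤ (T - t) ^ 2 := by nlinarith
  gcongr

lemma ball_energy_le (h : IsSmoothConn Γ) (hflow : IsYMFlowOn Γ (Icc (-1) 1))
    {K : Set (Fin n → ℝ)} (hK : IsCompact K) (hs : SuppIn Γ K) {E : ℝ}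
    (hE : ∫ x, energyST Γ (-1, x) ≤ 2 * E) (x0 : Fin n → ℝ) {T t r : ℝ}
    (hT : T ∈ Icc (-(1 / 2) : ℝ) (1 / 8)) (ht : t ∈ Icc (-1 : ℝ) 1) (hr : 0 < r)
    (h1 : r ^ 2 < T - t) (h2 : T - t < 3 * r ^ 2) :
    r ^ 4 * ((3 * r ^ 2) ^ (-((n : ℝ) / 2)) * Real.exp (-1)) *
      ∫ x in {x : Fin n → ℝ | ∑ i, (x i - x0 i) ^ 2 < r ^ 2}, energyST Γ (t, x) ≤
        2 * 2 ^ ((n : ℝ) / 2) * (2 * E) := by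
  have htT : t < T := by nlinarith
  have hint (s : ℝ) : Integrable fun x => energyST Γ (s, x) :=
    integrable_of_vanish hK (continuous_slice (contDiff_energyST h) s) (energyST_eq_zero hK hs s)
  have hintw (s : ℝ) : Integrable fun x => energyST Γ (s, x) * wt x0 T s x :=
    integrable_of_vanish hK ((continuous_slice (contDiff_energyST h) s).mul (continuous_wt x0))
      fun x hx => by simp [energyST_eq_zero hK hs s x hx]
  have hmeas : MeasurableSet {x : Fin n → ℝ | ∑ i, (x i - x0 i) ^ 2 < r ^ 2} :=
    (isOpen_lt (by fun_prop) continuous_const).measurableSet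
  rw [← integral_const_mul]
  calc _ ≤ ∫ x in {x : Fin n → ℝ | ∑ i, (x i - x0 i) ^ 2 < r ^ 2},
        energyST Γ (t, x) * wt x0 T t x := by
        refine setIntegral_mono_on ((hint t).const_mul _).integrableOn (hintw t).integrableOn hmeas
          fun x hx => ?_
        rw [mul_comm]
        exact mul_le_mul_of_nonneg_left (le_wt hr h1 h2 hx) (energyST_nonneg _)
    _ ≤ wEnergy Γ x0 T t := setIntegral_le_integral (hintw t) (ae_of_all _ fun x =>
        mul_nonneg (energyST_nonneg _) (wt_nonneg x0 htT x))
    _ ≤ wEnergy Γ x0 T (-1) := wEnergy_le h hflow hK hs ht x0 htT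
    _ ≤ ∫ x, 2 * 2 ^ ((n : ℝ) / 2) * energyST Γ (-1, x) := by
        refine integral_mono (hintw _) ((hint _).const_mul _) fun x => ?_
        dsimp only
        rw [mul_comm]
        exact mul_le_mul_of_nonneg_right (wt_le hT x) (energyST_nonneg _)
    _ ≤ 2 * 2 ^ ((n : ℝ) / 2) * (2 * E) := by
        rw [integral_const_mul]
        gcongr

end EnergyBound

/-- (Uniform local parabolic energy bound.) There is `C = C(n,E)` such that
every compactly supported smooth solution of Yang–Mills flow on `ℝⁿ × [−1,1]` with energy
bounded by `E` satisfies `r^{2−n} ∫_{P_r(z)} |F|² ≤ C` for `t₀ ∈ [−1/2,0]` and `r ∈ (0,1/4]`. -/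
theorem uniform_local_parabolic_energy_bound
    (n : ℕ) (hn : 2 ≤ n) (E : ℝ) (hE : 0 < E) :
    ∃ C : ℝ, 0 < C ∧ ∀ (k : ℕ) (Γ : Conn n k),
      IsSmoothConn Γ → IsYMFlowOn Γ (Icc (-1) 1) →
      (∃ K : Set (Fin n → ℝ), IsCompact K ∧ SuppIn Γ K) →
      (∀ t ∈ Icc (-1 : ℝ) 1, 1 / 2 * ∫ x : Fin n → ℝ, normF2 Γ t x ≤ E) →
      ∀ (x0 : Fin n → ℝ) (t0 : ℝ), t0 ∈ Icc (-(1 / 2) : ℝ) 0 →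
        ∀ r : ℝ, r ∈ Ioc (0 : ℝ) (1 / 4) →
          r ^ ((2 : ℝ) - n) *
              ∫ t in Ioo (t0 - r ^ 2) (t0 + r ^ 2),
                ∫ x in {x : Fin n → ℝ | ∑ i, (x i - x0 i) ^ 2 < r ^ 2}, normF2 Γ t x
            ≤ C := by
  refine ⟨8 * 2 ^ ((n : ℝ) / 2) * E * (3 ^ ((n : ℝ) / 2) * Real.exp 1), by positivity, ?_⟩
  rintro k Γ h hflow ⟨K, hK, hs⟩ hE' x0 t0 ⟨ht0, ht0'⟩ r ⟨hr, hr'⟩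
  have hr2 : r ^ 2 ≤ 1 / 16 := by nlinarith
  simp only [normF2_eq h] at hE' ⊢
  have hE0 : ∫ x, energyST Γ (-1, x) ≤ 2 * E := by
    linarith [hE' (-1) (by norm_num)]
  set c := r ^ 4 * ((3 * r ^ 2) ^ (-((n : ℝ) / 2)) * Real.exp (-1)) with hc
  have hc0 : 0 < c := by positivity
  have hbound : ‖∫ t in Ioo (t0 - r ^ 2) (t0 + r ^ 2),
      ∫ x in {x : Fin n → ℝ | ∑ i, (x i - x0 i) ^ 2 < r ^ 2}, energyST Γ (t, x)‖ ≤
        (2 * 2 ^ ((n : ℝ) / 2) * (2 * E) / c) * volume.real (Ioo (t0 - r ^ 2) (t0 + r ^ 2)) := by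
    refine norm_setIntegral_le_of_norm_le_const (by simp) fun t ht => ?_
    rw [Real.norm_of_nonneg (integral_nonneg fun x => energyST_nonneg _), le_div_iff₀' hc0]
    exact ball_energy_le h hflow hK hs hE0 x0 (T := t0 + 2 * r ^ 2)
      ⟨by nlinarith, by linarith⟩ ⟨by linarith [ht.1], by linarith [ht.2]⟩ hr
      (by linarith [ht.2]) (by linarith [ht.1])
  have hvol : volume.real (Ioo (t0 - r ^ 2) (t0 + r ^ 2)) = 2 * r ^ 2 := by
    rw [Real.volume_real_Ioo_of_le (by nlinarith)]
    ring
  rw [hvol] at hbound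
  have hpow : (3 * r ^ 2) ^ (-((n : ℝ) / 2)) = (3 ^ ((n : ℝ) / 2) * r ^ (n : ℝ))⁻¹ := by
    rw [Real.rpow_neg (by positivity), Real.mul_rpow (by norm_num) (by positivity),
      ← Real.rpow_natCast r 2, ← Real.rpow_mul hr.le]
    congr 3
    push_cast
    ring
  calc _ ≤ r ^ ((2 : ℝ) - n) * ((2 * 2 ^ ((n : ℝ) / 2) * (2 * E) / c) * (2 * r ^ 2)) := by
        gcongr
        exact (le_abs_self _).trans hbound
    _ = 8 * 2 ^ ((n : ℝ) / 2) * E * (3 ^ ((n : ℝ) / 2) * Real.exp 1) := by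
        rw [hc, hpow, Real.exp_neg, Real.rpow_sub hr, Real.rpow_two]
        have : r ^ (n : ℝ) ≠ 0 := (Real.rpow_pos_of_pos hr _).ne'
        field_simp
        ring

end
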